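/- Let X, Y : [0,1] → ℝ^d be curves and δ ≥ 0. Let p₁, …, p_m ∈ [0,1]² be points, each of elevation at most δ, whose x-coordinates are nondecreasing, and let ψ_i denote the price of the tunnel from p_i to p_m, for 1 ≤ i ≤ m. Then: (A) if ψ_i ≥ δ, then for all j with i < j ≤ m one has ψ_j ≤ 3ψ_i; and (B) if ψ_i > 3δ, then for all j with 1 ≤ j < i one has ψ_j ≥ ψ_i/3. -/

import Mathlib

open Set

noncomputable section

namespace Jaywalk

variable {d : ℕ}

/-- An orientation-preserving reparameterization of `[0,1]`: a continuous, strictly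
increasing bijection of `[0,1]` onto itself with `f 0 = 0` and `f 1 = 1`. -/
structure IsReparam (f : ℝ → ℝ) : Prop where
  contOn : ContinuousOn f (Icc 0 1)
  strictMonoOn : StrictMonoOn f (Icc 0 1)
  mapsTo : MapsTo f (Icc 0 1) (Icc 0 1)
  surjOn : SurjOn f (Icc 0 1) (Icc 0 1)
  map_zero : f 0 = 0
  map_one : f 1 = 1

/-- The width of a reparameterization `f` with respect to curves `X Y : [0,1] → ℝ^d`. -/
def frechetWidth (X Y : ℝ → EuclideanSpace ℝ (Fin d)) (f : ℝ → ℝ) : ℝ :=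
  ⨆ t : Icc (0:ℝ) 1, ‖X (f ↑t) - Y ↑t‖

/-- The Fréchet distance between two curves `X Y : [0,1] → ℝ^d`. -/
def frechetDist (X Y : ℝ → EuclideanSpace ℝ (Fin d)) : ℝ :=
  sInf {w | ∃ f, IsReparam f ∧ w = frechetWidth X Y f}

/-- The segment from `p` to `q`, as a curve `t ↦ (1-t)·p + t·q`. -/
def seg (p q : EuclideanSpace ℝ (Fin d)) : ℝ → EuclideanSpace ℝ (Fin d) :=
  fun t => (1 - t) • p + t • q

/-- The subcurve `Z[s,t]`, affinely reparameterized over `[0,1]`. -/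
def subcurve (Z : ℝ → EuclideanSpace ℝ (Fin d)) (s t : ℝ) : ℝ → EuclideanSpace ℝ (Fin d) :=
  fun τ => Z (s + τ * (t - s))

/-- Vertices extended to all of `ℕ` (clamped at `n`). -/
def vtx {n : ℕ} (v : Fin (n+1) → EuclideanSpace ℝ (Fin d)) (i : ℕ) :
    EuclideanSpace ℝ (Fin d) :=
  v ⟨min i n, Nat.lt_succ_of_le (min_le_right i n)⟩

/-- The uniformly parameterized polygonal curve through the vertices `v 0, …, v n`. -/
def polyCurve {n : ℕ} (v : Fin (n+1) → EuclideanSpace ℝ (Fin d)) :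
    ℝ → EuclideanSpace ℝ (Fin d) :=
  fun t =>
    (1 - (t * n - ⌊t * n⌋₊)) • vtx v ⌊t * n⌋₊ + (t * n - ⌊t * n⌋₊) • vtx v (⌊t * n⌋₊ + 1)

/-- Concatenation of two curves (sharing an endpoint). -/
def concat (A B : ℝ → EuclideanSpace ℝ (Fin d)) : ℝ → EuclideanSpace ℝ (Fin d) :=
  fun t => if t ≤ 1/2 then A (2 * t) else B (2 * t - 1)

/-- Concatenation of a finite list of curves. -/
def concatList : List (ℝ → EuclideanSpace ℝ (Fin d)) → ℝ → EuclideanSpace ℝ (Fin d)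
  | [] => fun _ => 0
  | [A] => A
  | A :: B :: rest => concat A (concatList (B :: rest))

/-- Given curves `X Y`, the price of the tunnel from `a` to `b` (points of `[0,1]²`):
the Fréchet distance between the subcurve `X[a.1, b.1]` and the segment from
`Y a.2` to `Y b.2`. -/
def tunnelPrice (X Y : ℝ → EuclideanSpace ℝ (Fin d)) (a b : ℝ × ℝ) : ℝ :=
  frechetDist (subcurve X a.1 b.1) (seg (Y a.2) (Y b.2))

open Classical in
/-- Indices of marked vertices in the greedy `μ`-simplification of the polygonal curve with
vertices `v 0, …, v n`:  start at vertex `0`; repeatedly jump to the first later vertex at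
distance at least `μ` from the current one; finally also mark the last vertex `n`
(the sequence stabilizes at `n`). -/
def simplIdx (v : ℕ → EuclideanSpace ℝ (Fin d)) (μ : ℝ) (n : ℕ) : ℕ → ℕ
  | 0 => 0
  | k+1 =>
    if h : ∃ j, simplIdx v μ n k < j ∧ j ≤ n ∧ μ ≤ ‖v j - v (simplIdx v μ n k)‖
    then Nat.find h
    else n

/-- The vertices of the `μ`-simplification (with the final vertex repeated). -/
def simplVerts {n : ℕ} (v : Fin (n+1) → EuclideanSpace ℝ (Fin d)) (μ : ℝ) :
    Fin (n+1) → EuclideanSpace ℝ (Fin d) :=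
  fun k => vtx v (simplIdx (vtx v) μ n k.val)

/-- The `μ`-simplification `simpl(X, μ)` of the polygonal curve with vertices
`v 0, …, v n`: the polygonal curve through the marked vertices, in order. -/
def simpl {n : ℕ} (v : Fin (n+1) → EuclideanSpace ℝ (Fin d)) (μ : ℝ) :
    ℝ → EuclideanSpace ℝ (Fin d) :=
  polyCurve (simplVerts v μ)

/-- `y` is the parameter of a vertex of a (uniformly parameterized) polygonal curve
with `n` edges. -/
def vertexParam (n : ℕ) (y : ℝ) : Prop := ∃ i : Fin (n+1), y = ((i : ℕ) : ℝ) / n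

/-- The shortcut curve of `Y` determined by the list of shortcut parameter pairs,
starting from parameter `a`. -/
def shortcutFrom (Y : ℝ → EuclideanSpace ℝ (Fin d)) :
    List (ℝ × ℝ) → ℝ → ℝ → EuclideanSpace ℝ (Fin d)
  | [], a => subcurve Y a 1
  | (y₁, y₂) :: rest, a =>
      concat (subcurve Y a y₁) (concat (seg (Y y₁) (Y y₂)) (shortcutFrom Y rest y₂))

/-- The shortcut parameter pairs form a nondecreasing sequence inside `[0,1]` and all
parameters are vertices of the polygonal curve with `n` edges. -/
def ValidShortcuts (n : ℕ) (L : List (ℝ × ℝ)) : Prop :=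
  List.Chain' (· ≤ ·) ((0:ℝ) :: (L.flatMap fun p => [p.1, p.2]) ++ [1]) ∧
  ∀ p ∈ L, vertexParam n p.1 ∧ vertexParam n p.2

/-- The directed vertex-restricted `k`-shortcut Fréchet distance between a curve `X` and the
polygonal curve with vertices `w 0, …, w n`: the infimum of the Fréchet distance between `X`
and any vertex-restricted shortcut curve of `polyCurve w` with at most `k` shortcuts. -/
def shortcutFrechetDist {n : ℕ} (X : ℝ → EuclideanSpace ℝ (Fin d))
    (w : Fin (n+1) → EuclideanSpace ℝ (Fin d)) (k : ℕ) : ℝ :=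
  sInf {r | ∃ L : List (ℝ × ℝ), L.length ≤ k ∧ ValidShortcuts n L ∧
    r = frechetDist X (shortcutFrom (polyCurve w) L 0)}

/-- The directed vertex-restricted shortcut Fréchet distance (unbounded number of
shortcuts). -/
def shortcutFrechetDistUnbounded {n : ℕ} (X : ℝ → EuclideanSpace ℝ (Fin d))
    (w : Fin (n+1) → EuclideanSpace ℝ (Fin d)) : ℝ :=
  sInf {r | ∃ L : List (ℝ × ℝ), ValidShortcuts n L ∧
    r = frechetDist X (shortcutFrom (polyCurve w) L 0)}

theorem IsReparam.id : IsReparam (fun t => t) where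
  contOn := continuousOn_id
  strictMonoOn := fun _ _ _ _ h => h
  mapsTo := fun _ h => h
  surjOn := fun t h => ⟨t, h, rfl⟩
  map_zero := rfl
  map_one := rfl

/-- A continuous, strictly increasing function fixing `0` and `1` is a reparameterization. -/
theorem IsReparam.of_strictMonoOn {f : ℝ → ℝ} (hc : ContinuousOn f (Icc 0 1))
    (hm : StrictMonoOn f (Icc 0 1)) (h0 : f 0 = 0) (h1 : f 1 = 1) : IsReparam f where
  contOn := hc
  strictMonoOn := hm
  mapsTo := fun t ht => by
    have hl := hm.monotoneOn (left_mem_Icc.2 zero_le_one) ht ht.1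
    have hr := hm.monotoneOn ht (right_mem_Icc.2 zero_le_one) ht.2
    rw [h0] at hl
    rw [h1] at hr
    exact ⟨hl, hr⟩
  surjOn := by
    have h := intermediate_value_Icc zero_le_one hc
    rwa [h0, h1] at h
  map_zero := h0
  map_one := h1

theorem affine_mem_Icc {s t : ℝ} (hs : s ∈ Icc (0:ℝ) 1) (ht : t ∈ Icc (0:ℝ) 1) :
    s + t * (1 - s) ∈ Icc (0:ℝ) 1 :=
  ⟨add_nonneg hs.1 (mul_nonneg ht.1 (sub_nonneg.2 hs.2)),
    by nlinarith [mul_nonneg (sub_nonneg.2 ht.2) (sub_nonneg.2 hs.2)]⟩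

/-- The restriction of a reparameterization to `[s,1]`, rescaled to `[0,1]`. -/
theorem IsReparam.restrict {f : ℝ → ℝ} (hf : IsReparam f) {s : ℝ} (hs : s ∈ Icc (0:ℝ) 1)
    (hfs : f s < 1) : IsReparam (fun t => (f (s + t * (1 - s)) - f s) / (1 - f s)) := by
  have hpos : 0 < 1 - f s := sub_pos.2 hfs
  have hs1 : 0 < 1 - s := by
    refine sub_pos.2 (lt_of_le_of_ne hs.2 ?_)
    rintro rfl
    exact hfs.ne hf.map_one
  refine IsReparam.of_strictMonoOn ?_ ?_ (by simp) ?_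
  · refine ContinuousOn.div_const (ContinuousOn.sub ?_ continuousOn_const) _
    exact hf.contOn.comp (by fun_prop) fun t ht => affine_mem_Icc hs ht
  · intro a ha b hb hab
    have h := hf.strictMonoOn (affine_mem_Icc hs ha) (affine_mem_Icc hs hb)
      (by gcongr : s + a * (1 - s) < s + b * (1 - s))
    exact div_lt_div_of_pos_right (sub_lt_sub_right h _) hpos
  · have h : s + 1 * (1 - s) = 1 := by ring
    simp only [h, hf.map_one, div_self hpos.ne']

theorem frechetWidth_nonneg (X Y : ℝ → EuclideanSpace ℝ (Fin d)) (f : ℝ → ℝ) :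
    0 ≤ frechetWidth X Y f :=
  Real.iSup_nonneg fun _ => norm_nonneg _

theorem frechetDist_nonneg (X Y : ℝ → EuclideanSpace ℝ (Fin d)) : 0 ≤ frechetDist X Y := by
  refine Real.sInf_nonneg ?_
  rintro _ ⟨f, -, rfl⟩
  exact frechetWidth_nonneg X Y f

theorem norm_le_frechetWidth {X Y : ℝ → EuclideanSpace ℝ (Fin d)} {f : ℝ → ℝ}
    (hX : ContinuousOn X (Icc 0 1)) (hY : ContinuousOn Y (Icc 0 1)) (hf : IsReparam f)
    {t : ℝ} (ht : t ∈ Icc (0:ℝ) 1) : ‖X (f t) - Y t‖ ≤ frechetWidth X Y f := by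
  have hc : ContinuousOn (fun t => ‖X (f t) - Y t‖) (Icc 0 1) :=
    ((hX.comp hf.contOn hf.mapsTo).sub hY).norm
  obtain ⟨C, hC⟩ := (isCompact_Icc.image_of_continuousOn hc).bddAbove
  have hb : BddAbove (range fun t : Icc (0:ℝ) 1 => ‖X (f ↑t) - Y ↑t‖) := by
    refine ⟨C, ?_⟩
    rintro _ ⟨u, rfl⟩
    exact hC ⟨u, u.2, rfl⟩
  exact le_ciSup hb ⟨t, ht⟩

theorem frechetDist_le {X Y : ℝ → EuclideanSpace ℝ (Fin d)} {f : ℝ → ℝ} (hf : IsReparam f)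
    {c : ℝ} (h : ∀ t ∈ Icc (0:ℝ) 1, ‖X (f t) - Y t‖ ≤ c) : frechetDist X Y ≤ c := by
  have hb : BddBelow {w | ∃ f, IsReparam f ∧ w = frechetWidth X Y f} := by
    refine ⟨0, ?_⟩
    rintro _ ⟨g, -, rfl⟩
    exact frechetWidth_nonneg X Y g
  have : Nonempty (Icc (0:ℝ) 1) := ⟨⟨0, left_mem_Icc.2 zero_le_one⟩⟩
  exact (csInf_le hb ⟨f, hf, rfl⟩).trans (ciSup_le fun t => h t t.2)

theorem exists_reparam_of_frechetDist_lt {X Y : ℝ → EuclideanSpace ℝ (Fin d)}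
    (hX : ContinuousOn X (Icc 0 1)) (hY : ContinuousOn Y (Icc 0 1)) {w : ℝ}
    (h : frechetDist X Y < w) :
    ∃ f, IsReparam f ∧ ∀ t ∈ Icc (0:ℝ) 1, ‖X (f t) - Y t‖ ≤ w := by
  have hne : {w | ∃ f, IsReparam f ∧ w = frechetWidth X Y f}.Nonempty :=
    ⟨_, _, IsReparam.id, rfl⟩
  obtain ⟨_, ⟨f, hf, rfl⟩, hw⟩ := exists_lt_of_csInf_lt hne h
  exact ⟨f, hf, fun t ht => (norm_le_frechetWidth hX hY hf ht).trans hw.le⟩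

theorem continuous_seg (p q : EuclideanSpace ℝ (Fin d)) : Continuous (seg p q) := by
  unfold seg
  fun_prop

theorem continuousOn_subcurve {Z : ℝ → EuclideanSpace ℝ (Fin d)}
    (hZ : ContinuousOn Z (Icc 0 1)) {s t : ℝ} (hs : 0 ≤ s) (hst : s ≤ t) (ht : t ≤ 1) :
    ContinuousOn (subcurve Z s t) (Icc 0 1) := by
  refine hZ.comp (by fun_prop) fun τ hτ => ⟨?_, ?_⟩
  · exact add_nonneg hs (mul_nonneg hτ.1 (sub_nonneg.2 hst))
  · nlinarith [mul_nonneg (sub_nonneg.2 hτ.2) (sub_nonneg.2 hst)]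

/-- The tunnel over a single point of `X` costs at most the elevation of its endpoints. -/
theorem tunnelPrice_le_of_fst_eq {X Y : ℝ → EuclideanSpace ℝ (Fin d)} {δ : ℝ} {b c : ℝ × ℝ}
    (hbc : b.1 = c.1) (hb : ‖X b.1 - Y b.2‖ ≤ δ) (hc : ‖X c.1 - Y c.2‖ ≤ δ) :
    tunnelPrice X Y b c ≤ δ := by
  refine frechetDist_le IsReparam.id fun t ht => ?_
  have heq : subcurve X b.1 c.1 t - seg (Y b.2) (Y c.2) t =
      (1 - t) • (X b.1 - Y b.2) + t • (X c.1 - Y c.2) := by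
    simp only [subcurve, seg, hbc, sub_self, mul_zero, add_zero]
    module
  have h := convex_closedBall (0 : EuclideanSpace ℝ (Fin d)) δ
    (mem_closedBall_zero_iff.2 hb) (mem_closedBall_zero_iff.2 hc)
    (sub_nonneg.2 ht.2) ht.1 (sub_add_cancel 1 t)
  rw [heq]
  exact mem_closedBall_zero_iff.1 h

/-- Starting a tunnel at a later point of the `δ`-free space at most doubles its price,
up to an additive `δ`. -/
theorem tunnelPrice_le_two_mul_add {X Y : ℝ → EuclideanSpace ℝ (Fin d)}
    (hX : ContinuousOn X (Icc 0 1)) {δ : ℝ} {a b c : ℝ × ℝ} (ha : 0 ≤ a.1) (hab : a.1 ≤ b.1)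
    (hbc : b.1 ≤ c.1) (hc : c.1 ≤ 1) (hbδ : ‖X b.1 - Y b.2‖ ≤ δ)
    (hcδ : ‖X c.1 - Y c.2‖ ≤ δ) :
    tunnelPrice X Y b c ≤ 2 * tunnelPrice X Y a c + δ := by
  have hnonneg : 0 ≤ tunnelPrice X Y a c := frechetDist_nonneg _ _
  obtain hbc' | hbc' := hbc.eq_or_lt
  · linarith [tunnelPrice_le_of_fst_eq hbc' hbδ hcδ]
  have hL : 0 < c.1 - a.1 := sub_pos.2 (hab.trans_lt hbc')
  suffices h : ∀ w, tunnelPrice X Y a c < w → tunnelPrice X Y b c ≤ 2 * w + δ by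
    refine le_of_forall_pos_le_add fun ε hε => ?_
    linarith [h (tunnelPrice X Y a c + ε / 2) (by linarith)]
  intro w hw
  obtain ⟨f, hf, hfw⟩ := exists_reparam_of_frechetDist_lt
    (continuousOn_subcurve hX ha (hab.trans hbc) hc) (continuous_seg _ _).continuousOn hw
  obtain ⟨s, hs, hfs⟩ := hf.surjOn
    (show (b.1 - a.1) / (c.1 - a.1) ∈ Icc (0:ℝ) 1 from
      ⟨div_nonneg (sub_nonneg.2 hab) hL.le, (div_le_one hL).2 (sub_le_sub_right hbc _)⟩)
  have hfs1 : f s < 1 := by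
    rw [hfs, div_lt_one hL]
    exact sub_lt_sub_right hbc' _
  have hb_eq : b.1 = a.1 + f s * (c.1 - a.1) := by
    rw [hfs, div_mul_cancel₀ _ hL.ne']
    ring
  have hstart : ‖seg (Y a.2) (Y c.2) s - Y b.2‖ ≤ w + δ := by
    have h := hfw s hs
    rw [subcurve, ← hb_eq, norm_sub_rev] at h
    exact (norm_sub_le_norm_sub_add_norm_sub _ (X b.1) _).trans (add_le_add h hbδ)
  refine frechetDist_le (hf.restrict hs hfs1) fun t ht => ?_
  have hcurve : subcurve X b.1 c.1 ((f (s + t * (1 - s)) - f s) / (1 - f s)) =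
      subcurve X a.1 c.1 (f (s + t * (1 - s))) := by
    have hne : 1 - f s ≠ 0 := (sub_pos.2 hfs1).ne'
    simp only [subcurve]
    congr 1
    rw [hb_eq]
    field_simp
    ring
  have hseg : seg (Y a.2) (Y c.2) (s + t * (1 - s)) - seg (Y b.2) (Y c.2) t =
      (1 - t) • (seg (Y a.2) (Y c.2) s - Y b.2) := by
    simp only [seg]
    module
  have hshift : ‖seg (Y a.2) (Y c.2) (s + t * (1 - s)) - seg (Y b.2) (Y c.2) t‖ ≤ w + δ := by
    rw [hseg, norm_smul, Real.norm_of_nonneg (sub_nonneg.2 ht.2)]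
    exact (mul_le_of_le_one_left (norm_nonneg _) (by linarith [ht.1])).trans hstart
  rw [hcurve]
  linarith [hfw _ (affine_mem_Icc hs ht), norm_sub_le_norm_sub_add_norm_sub
    (subcurve X a.1 c.1 (f (s + t * (1 - s)))) (seg (Y a.2) (Y c.2) (s + t * (1 - s)))
    (seg (Y b.2) (Y c.2) t)]

/-- Let `p 0, …, p (m-1)` be points of the `δ`-free space with nondecreasing
`x`-coordinates, and `ψ i` the price of the tunnel from `p i` to the last point. Then:
(A) if `ψ i ≥ δ`, all later tunnels have price at most `3 ψ i`; and
(B) if `ψ i > 3δ`, all earlier tunnels have price at least `ψ i / 3`. -/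
theorem tunnelPrice_matrix_mono {d : ℕ} (X Y : ℝ → EuclideanSpace ℝ (Fin d))
    (hX : ContinuousOn X (Icc 0 1)) (hY : ContinuousOn Y (Icc 0 1))
    (δ : ℝ) (hδ : 0 ≤ δ) (m : ℕ) (hm : 1 ≤ m) (p : Fin m → ℝ × ℝ)
    (hmem : ∀ i, p i ∈ (Icc (0:ℝ) 1) ×ˢ (Icc (0:ℝ) 1))
    (helev : ∀ i, ‖X (p i).1 - Y (p i).2‖ ≤ δ)
    (hmono : ∀ i j : Fin m, i ≤ j → (p i).1 ≤ (p j).1) :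
    let last : Fin m := ⟨m - 1, by omega⟩
    let ψ : Fin m → ℝ := fun i => tunnelPrice X Y (p i) (p last)
    (∀ i j : Fin m, δ ≤ ψ i → i < j → ψ j ≤ 3 * ψ i) ∧
    (∀ i j : Fin m, 3 * δ < ψ i → j < i → ψ i / 3 ≤ ψ j) := by
  intro last ψ
  have key : ∀ i j : Fin m, i < j → ψ j ≤ 2 * ψ i + δ := fun i j hij =>
    tunnelPrice_le_two_mul_add hX (hmem i).1.1 (hmono i j hij.le)
      (hmono j last (Fin.le_def.2 (Nat.le_sub_one_of_lt j.2))) (hmem last).1.2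
      (helev j) (helev last)
  refine ⟨fun i j hi hij => ?_, fun i j hi hji => ?_⟩
  · linarith [key i j hij]
  · linarith [key j i hji]

end Jaywalk
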